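/- arXiv:2401.01086 — 2 statements merged into one kernel-verified Lean document; each statement's English description precedes it below -/
import Mathlib

section
/- Let μ and ν be finite positive Borel measures on ℝ^d satisfying Assumption 1, and let φ⁺, φ⁻ be finite positive Borel measures on ℝ^d with all moments finite such that M_n(φ⁺) ⪯ M_n(μ) and M_n(φ⁻) ⪯ M_n(ν) for every n ∈ ℕ, and ∫ x^α dφ⁺ − ∫ x^α dφ⁻ = ∫ x^α dμ − ∫ x^α dν for every α ∈ ℕ^d. Then φ⁺ + ν = φ⁻ + μ as measures, i.e. φ⁺ − φ⁻ = μ − ν as signed measures. -/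
open MeasureTheory Finset Filter

noncomputable section

/-- The monomial `x ↦ x^α`. -/
def mono (d : ℕ) (α : Fin d → ℕ) (x : Fin d → ℝ) : ℝ := ∏ i, x i ^ α i

/-- All moments of `μ` are finite. -/
def HasAllMoments {d : ℕ} (μ : Measure (Fin d → ℝ)) : Prop :=
  ∀ α : Fin d → ℕ, Integrable (mono d α) μ

/-- The moment `μ_α = ∫ x^α dμ`. -/
def mMom {d : ℕ} (μ : Measure (Fin d → ℝ)) (α : Fin d → ℕ) : ℝ := ∫ x, mono d α x ∂μ

instance fintypeIdx (d n : ℕ) : Fintype {α : Fin d → ℕ // ∑ i, α i ≤ n} :=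
  Fintype.ofInjective
    (fun a => (fun i => (⟨a.1 i,
        Nat.lt_succ_of_le (le_trans
          (Finset.single_le_sum (fun j _ => Nat.zero_le (a.1 j)) (Finset.mem_univ i)) a.2)⟩ :
        Fin (n+1))) : _ → (Fin d → Fin (n+1)))
    (fun a b h => by
      apply Subtype.ext
      funext i
      exact congrArg Fin.val (congrFun h i))

/-- Moment matrix of order `n` built from a moment function `m`. -/
def momMat (d n : ℕ) (m : (Fin d → ℕ) → ℝ) :
    Matrix {α : Fin d → ℕ // ∑ i, α i ≤ n} {α : Fin d → ℕ // ∑ i, α i ≤ n} ℝ :=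
  fun a b => m (a.1 + b.1)

/-- Carleman's condition. -/
def Carleman {d : ℕ} (μ : Measure (Fin d → ℝ)) : Prop :=
  ∀ i : Fin d, ¬ Summable (fun j : ℕ =>
    (∫ x, x i ^ (2 * (j + 1)) ∂μ) ^ (-(1 : ℝ) / (2 * (j + 1) : ℝ)))

/-- Positive part of the Hahn–Jordan decomposition of `μ - ν`. -/
def hjPos {d : ℕ} (μ ν : Measure (Fin d → ℝ)) [IsFiniteMeasure μ] [IsFiniteMeasure ν] :
    Measure (Fin d → ℝ) :=
  (μ.toSignedMeasure - ν.toSignedMeasure).toJordanDecomposition.posPart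

/-- Negative part of the Hahn–Jordan decomposition of `μ - ν`. -/
def hjNeg {d : ℕ} (μ ν : Measure (Fin d → ℝ)) [IsFiniteMeasure μ] [IsFiniteMeasure ν] :
    Measure (Fin d → ℝ) :=
  (μ.toSignedMeasure - ν.toSignedMeasure).toJordanDecomposition.negPart

/-- Total variation distance `‖μ - ν‖_TV` (as a real number). -/
def tvReal {d : ℕ} (μ ν : Measure (Fin d → ℝ)) [IsFiniteMeasure μ] [IsFiniteMeasure ν] : ℝ :=
  (hjPos μ ν Set.univ + hjNeg μ ν Set.univ).toReal

/-- Degree-`2n` pseudo-moment vectors. -/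
abbrev PV (d n : ℕ) := {α : Fin d → ℕ // ∑ i, α i ≤ 2 * n} → ℝ

/-- Moment matrix of a degree-`2n` pseudo-moment vector. -/
def pvMat (d n : ℕ) (φ : PV d n) :
    Matrix {α : Fin d → ℕ // ∑ i, α i ≤ n} {α : Fin d → ℕ // ∑ i, α i ≤ n} ℝ :=
  fun a b => φ ⟨a.1 + b.1, by
    have h : ∑ i, (a.1 + b.1) i = (∑ i, a.1 i) + ∑ i, b.1 i := by
      simp [Finset.sum_add_distrib]
    have ha := a.2
    have hb := b.2
    omega⟩

/-- The index `α = 0`. -/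
def zeroIdx (d n : ℕ) : {α : Fin d → ℕ // ∑ i, α i ≤ 2 * n} := ⟨0, by simp⟩

/-- Feasibility for the level-`n` semidefinite relaxation. -/
def Feas (d n : ℕ) (μ ν : Measure (Fin d → ℝ)) (φ ψ : PV d n) : Prop :=
  (∀ α, φ α - ψ α = mMom μ α.1 - mMom ν α.1) ∧
  (pvMat d n φ).PosSemidef ∧ (momMat d n (mMom μ) - pvMat d n φ).PosSemidef ∧
  (pvMat d n ψ).PosSemidef ∧ (momMat d n (mMom ν) - pvMat d n ψ).PosSemidef

/-- Values of the level-`n` semidefinite relaxation. -/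
def primalSet (d n : ℕ) (μ ν : Measure (Fin d → ℝ)) : Set ℝ :=
  {r | ∃ φ ψ : PV d n, Feas d n μ ν φ ψ ∧ r = φ (zeroIdx d n) + ψ (zeroIdx d n)}

/-- The optimal value `ρ_n` of the level-`n` semidefinite relaxation. -/
def rho (d n : ℕ) (μ ν : Measure (Fin d → ℝ)) : ℝ := sInf (primalSet d n μ ν)


/-- Assumption 1: all moments of `μ` and `ν` are finite, and there is `c > 0` with
`∫ exp(c|x_i|) dμ < ∞` and `∫ exp(c|x_i|) dν < ∞` for every coordinate `i`. -/
def Assumption1 {d : ℕ} (μ ν : Measure (Fin d → ℝ)) : Prop :=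
  HasAllMoments μ ∧ HasAllMoments ν ∧
  ∃ c : ℝ, 0 < c ∧ (∀ i : Fin d, Integrable (fun x => Real.exp (c * |x i|)) μ) ∧
    (∀ i : Fin d, Integrable (fun x => Real.exp (c * |x i|)) ν)

lemma aux_lintegral_cosh {Ω : Type*} [MeasurableSpace Ω] (ρ : Measure Ω) (X : Ω → ℝ)
    (hX : Measurable X) (hint : ∀ n : ℕ, Integrable (fun ω => X ω ^ n) ρ) (c : ℝ) :
    ∫⁻ ω, ENNReal.ofReal (Real.cosh (c * X ω)) ∂ρ =
      ∑' k : ℕ, ENNReal.ofReal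
        (c ^ (2 * k) / ((2 * k).factorial : ℝ) * ∫ ω, X ω ^ (2 * k) ∂ρ) := by
  have h0 : ∀ ω, ENNReal.ofReal (Real.cosh (c * X ω)) =
      ∑' k : ℕ, ENNReal.ofReal (c ^ (2 * k) / ((2 * k).factorial : ℝ) * X ω ^ (2 * k)) := by
    intro ω
    have h := Real.hasSum_cosh (c * X ω)
    rw [← h.tsum_eq, ENNReal.ofReal_tsum_of_nonneg _ h.summable]
    · congr 1
      ext k
      congr 1
      rw [mul_pow]; ring
    · intro k
      rw [pow_mul]; positivity
  simp_rw [h0]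
  rw [lintegral_tsum (fun k => by fun_prop)]
  congr 1
  ext k
  rw [← integral_const_mul, ofReal_integral_eq_lintegral_ofReal]
  · exact (hint _).const_mul _
  · refine ae_of_all _ fun ω => ?_
    simp only [pow_mul, Pi.zero_apply]
    positivity

lemma aux_exp_dom {Ω : Type*} [MeasurableSpace Ω] (μ φ : Measure Ω) (X : Ω → ℝ)
    (hX : Measurable X) (hμ : ∀ n : ℕ, Integrable (fun ω => X ω ^ n) μ)
    (hφ : ∀ n : ℕ, Integrable (fun ω => X ω ^ n) φ)
    (hdom : ∀ k : ℕ, ∫ ω, X ω ^ (2 * k) ∂φ ≤ ∫ ω, X ω ^ (2 * k) ∂μ) (c : ℝ) (hc : 0 < c)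
    (he : Integrable (fun ω => Real.exp (c * |X ω|)) μ) :
    Integrable (fun ω => Real.exp (c * |X ω|)) φ := by
  have hcosh : Integrable (fun ω => Real.cosh (c * X ω)) μ := by
    refine he.mono' (by fun_prop) (ae_of_all _ fun ω => ?_)
    rw [Real.norm_eq_abs, abs_of_pos (Real.cosh_pos _), ← Real.cosh_abs, abs_mul, abs_of_pos hc,
      Real.cosh_eq]
    have h1 : Real.exp (-(c * |X ω|)) ≤ Real.exp (c * |X ω|) := by
      apply Real.exp_le_exp.2
      have : 0 ≤ c * |X ω| := by positivity
      linarith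
    linarith
  have hlt : ∫⁻ ω, ENNReal.ofReal (Real.cosh (c * X ω)) ∂φ < ⊤ := by
    refine lt_of_le_of_lt ?_ hcosh.lintegral_lt_top
    rw [aux_lintegral_cosh φ X hX hφ, aux_lintegral_cosh μ X hX hμ]
    refine ENNReal.tsum_le_tsum fun k => ENNReal.ofReal_le_ofReal ?_
    refine mul_le_mul_of_nonneg_left (hdom k) ?_
    positivity
  have hcφ : Integrable (fun ω => Real.cosh (c * X ω)) φ := by
    refine ⟨by fun_prop, ?_⟩
    rw [hasFiniteIntegral_iff_ofReal (ae_of_all _ fun ω => (Real.cosh_pos _).le)]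
    exact hlt
  refine (hcφ.const_mul 2).mono' (by fun_prop) (ae_of_all _ fun ω => ?_)
  rw [Real.norm_eq_abs, abs_of_pos (Real.exp_pos _), ← Real.cosh_abs, abs_mul, abs_of_pos hc,
      Real.cosh_eq]
  have := Real.exp_pos (-(c * |X ω|))
  linarith

lemma aux_zero_mem {Ω : Type*} [MeasurableSpace Ω] (μ : Measure Ω) (X : Ω → ℝ)
    (hX : Measurable X) (s : ℝ) (hs : 0 < s)
    (h : Integrable (fun ω => Real.exp (s * |X ω|)) μ) :
    Set.Ioo (-s) s ⊆ interior (ProbabilityTheory.integrableExpSet X μ) := by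
  rw [isOpen_Ioo.subset_interior_iff]
  intro t ht
  refine h.mono' (by fun_prop) (ae_of_all _ fun ω => ?_)
  rw [Real.norm_eq_abs, abs_of_pos (Real.exp_pos _)]
  apply Real.exp_le_exp.2
  refine (le_abs_self _).trans ?_
  rw [abs_mul]
  exact mul_le_mul_of_nonneg_right (abs_lt.2 ht).le (abs_nonneg _)

lemma aux_cexp_eq {Ω : Type*} [MeasurableSpace Ω] (A B : Measure Ω) (X : Ω → ℝ)
    (hX : Measurable X) (s : ℝ) (hs : 0 < s)
    (hA : Integrable (fun ω => Real.exp (s * |X ω|)) A)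
    (hB : Integrable (fun ω => Real.exp (s * |X ω|)) B)
    (hm : ∀ n : ℕ, ∫ ω, X ω ^ n ∂A = ∫ ω, X ω ^ n ∂B) :
    ProbabilityTheory.complexMGF X A Complex.I = ProbabilityTheory.complexMGF X B Complex.I := by
  have hA' := aux_zero_mem A X hX s hs hA
  have hB' := aux_zero_mem B X hX s hs hB
  set U : Set ℂ := Complex.re ⁻¹' (Set.Ioo (-s) s) with hU
  have hAa : AnalyticOnNhd ℂ (ProbabilityTheory.complexMGF X A) U :=
    fun z hz => ProbabilityTheory.analyticAt_complexMGF (hA' hz)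
  have hBa : AnalyticOnNhd ℂ (ProbabilityTheory.complexMGF X B) U :=
    fun z hz => ProbabilityTheory.analyticAt_complexMGF (hB' hz)
  have h0 : (0 : ℂ) ∈ U := by simp [hU, hs]
  have hI : Complex.I ∈ U := by simp [hU, hs]
  have hconv : IsPreconnected U :=
    ((convex_Ioo (-s) s).linear_preimage Complex.reLm).isPreconnected
  refine hAa.eqOn_of_preconnected_of_eventuallyEq hBa hconv h0 ?_ hI
  have e1 := (hAa 0 h0).hasFPowerSeriesAt
  have e2 := (hBa 0 h0).hasFPowerSeriesAt
  have : (fun n : ℕ => iteratedDeriv n (ProbabilityTheory.complexMGF X A) 0 / (n.factorial : ℂ)) =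
      fun n : ℕ => iteratedDeriv n (ProbabilityTheory.complexMGF X B) 0 / (n.factorial : ℂ) := by
    ext n
    rw [ProbabilityTheory.iteratedDeriv_complexMGF (hA' h0),
      ProbabilityTheory.iteratedDeriv_complexMGF (hB' h0)]
    congr 1
    have := congrArg (fun r : ℝ => (r : ℂ)) (hm n)
    simp only [← integral_complex_ofReal] at this
    simpa using this
  rw [this] at e1
  exact (e1.eventually_hasSum_sub.and e2.eventually_hasSum_sub).mono fun z hz => hz.1.unique hz.2

lemma aux_exp_lin {d : ℕ} (A : Measure (Fin d → ℝ)) [IsFiniteMeasure A] (c : ℝ) (hc : 0 < c)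
    (hA : ∀ i, Integrable (fun x => Real.exp (c * |x i|)) A) (t : Fin d → ℝ) :
    Integrable (fun x => Real.exp (c / (1 + ∑ i, |t i|) * |∑ i, x i * t i|)) A := by
  have hT : 0 ≤ ∑ i, |t i| := Finset.sum_nonneg fun i _ => abs_nonneg _
  refine ((integrable_const (1 : ℝ)).add (integrable_finsetSum univ fun i _ => hA i)).mono'
    (Continuous.aestronglyMeasurable (by fun_prop)) (ae_of_all _ fun x => ?_)
  rw [Real.norm_eq_abs, abs_of_pos (Real.exp_pos _)]
  have hb : |∑ i, x i * t i| ≤ ‖x‖ * ∑ i, |t i| := by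
    rw [Finset.mul_sum]
    refine (Finset.abs_sum_le_sum_abs _ _).trans (Finset.sum_le_sum fun i _ => ?_)
    rw [abs_mul]
    exact mul_le_mul_of_nonneg_right (norm_le_pi_norm x i) (abs_nonneg _)
  have hb2 : c / (1 + ∑ i, |t i|) * |∑ i, x i * t i| ≤ c * ‖x‖ := by
    rw [div_mul_eq_mul_div, div_le_iff₀ (by positivity), mul_assoc]
    refine mul_le_mul_of_nonneg_left ?_ hc.le
    have := norm_nonneg x
    nlinarith
  refine (Real.exp_le_exp.2 hb2).trans ?_
  simp only [Pi.add_apply]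
  have hnn : ∀ i ∈ (univ : Finset (Fin d)), 0 ≤ Real.exp (c * |x i|) := fun i _ => (Real.exp_pos _).le
  rcases isEmpty_or_nonempty (Fin d) with hd | hd
  · have : ‖x‖ = 0 := by simp [Subsingleton.elim x 0]
    simp [this]
  · obtain ⟨i, hi⟩ := Finite.exists_max (fun i => ‖x i‖)
    have hx : ‖x‖ ≤ |x i| := (pi_norm_le_iff_of_nonempty (r := ‖x i‖) x).2 hi
    have h1 : Real.exp (c * ‖x‖) ≤ Real.exp (c * |x i|) :=
      Real.exp_le_exp.2 (mul_le_mul_of_nonneg_left hx hc.le)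
    have h2 := Finset.single_le_sum hnn (Finset.mem_univ i)
    linarith

lemma aux_pow_lin {d : ℕ} (t x : Fin d → ℝ) (n : ℕ) :
    (∑ i, x i * t i) ^ n = ∑ k ∈ piAntidiag univ n,
      ((Nat.multinomial univ k : ℝ) * ∏ i, t i ^ k i) * mono d k x := by
  rw [Finset.sum_pow_eq_sum_piAntidiag]
  refine Finset.sum_congr rfl fun k _ => ?_
  simp only [mono, mul_pow, Finset.prod_mul_distrib]
  ring

lemma aux_measure_eq {d : ℕ} (A B : Measure (Fin d → ℝ)) [IsFiniteMeasure A] [IsFiniteMeasure B]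
    (hA : HasAllMoments A) (hB : HasAllMoments B) (hm : ∀ α, mMom A α = mMom B α)
    (c : ℝ) (hc : 0 < c)
    (heA : ∀ i, Integrable (fun x => Real.exp (c * |x i|)) A)
    (heB : ∀ i, Integrable (fun x => Real.exp (c * |x i|)) B) : A = B := by
  refine Measure.ext_of_charFunDual (funext fun L => ?_)
  obtain ⟨t, ht⟩ : ∃ t : Fin d → ℝ, ∀ x, L x = ∑ i, x i * t i := by
    refine ⟨fun i => L (Pi.single i 1), fun x => ?_⟩
    conv_lhs => rw [pi_eq_sum_univ' x]
    simp [map_sum]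
  have hT : 0 ≤ ∑ i, |t i| := Finset.sum_nonneg fun i _ => abs_nonneg _
  have key := aux_cexp_eq A B (fun x => ∑ i, x i * t i) (by fun_prop) _ (by positivity)
    (aux_exp_lin A c hc heA t) (aux_exp_lin B c hc heB t) ?_
  · simp only [ProbabilityTheory.complexMGF] at key
    simp only [charFunDual_apply, ht]
    simpa only [mul_comm] using key
  · intro n
    simp only [aux_pow_lin]
    rw [integral_finsetSum _ fun k _ => (hA k).const_mul _,
      integral_finsetSum _ fun k _ => (hB k).const_mul _]
    refine Finset.sum_congr rfl fun k _ => ?_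
    rw [integral_const_mul, integral_const_mul]
    congr 1
    exact hm k

lemma aux_mono_single {d : ℕ} (i : Fin d) (n : ℕ) (x : Fin d → ℝ) :
    mono d (Pi.single i n) x = x i ^ n := by
  unfold mono
  rw [Finset.prod_eq_single i]
  · simp
  · intro j _ hj
    simp [Pi.single_eq_of_ne hj]
  · simp

lemma aux_dom {d : ℕ} (μ φ : Measure (Fin d → ℝ)) (hμ : HasAllMoments μ) (hφ : HasAllMoments φ)
    (h : ∀ n : ℕ, (momMat d n (mMom μ) - momMat d n (mMom φ)).PosSemidef)
    (c : ℝ) (hc : 0 < c) (i : Fin d)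
    (he : Integrable (fun x => Real.exp (c * |x i|)) μ) :
    Integrable (fun x => Real.exp (c * |x i|)) φ := by
  refine aux_exp_dom μ φ (fun x => x i) (by fun_prop) (fun n => ?_) (fun n => ?_) (fun k => ?_)
    c hc he
  · exact (hμ (Pi.single i n)).congr (ae_of_all _ fun x => aux_mono_single i n x)
  · exact (hφ (Pi.single i n)).congr (ae_of_all _ fun x => aux_mono_single i n x)
  · have := (h k).diag_nonneg (i := ⟨Pi.single i k, by simp⟩)
    simp only [Matrix.sub_apply, momMat, mMom, ← Pi.single_add, aux_mono_single] at this
    rw [two_mul]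
    linarith

/-- Under Assumption 1, if `φ⁺, φ⁻` are finite positive measures with all
moments finite, dominated moment matrices at every level, and matching moments with
`μ - ν`, then `φ⁺ + ν = φ⁻ + μ`, i.e. `φ⁺ - φ⁻ = μ - ν` as signed measures. -/
theorem moment_constraints_imp_measure_eq (d : ℕ) (μ ν : Measure (Fin d → ℝ))
    [IsFiniteMeasure μ] [IsFiniteMeasure ν] (hA : Assumption1 μ ν)
    (φp φm : Measure (Fin d → ℝ)) [IsFiniteMeasure φp] [IsFiniteMeasure φm]
    (hφp : HasAllMoments φp) (hφm : HasAllMoments φm)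
    (h1 : ∀ n : ℕ, (momMat d n (mMom μ) - momMat d n (mMom φp)).PosSemidef)
    (h2 : ∀ n : ℕ, (momMat d n (mMom ν) - momMat d n (mMom φm)).PosSemidef)
    (h3 : ∀ α : Fin d → ℕ, mMom φp α - mMom φm α = mMom μ α - mMom ν α) :
    φp + ν = φm + μ := by
  obtain ⟨hμ, hν, c, hc, heμ, heν⟩ := hA
  refine aux_measure_eq (φp + ν) (φm + μ) (fun α => (hφp α).add_measure (hν α))
    (fun α => (hφm α).add_measure (hμ α)) (fun α => ?_) c hc
    (fun i => (aux_dom μ φp hμ hφp h1 c hc i (heμ i)).add_measure (heν i))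
    (fun i => (aux_dom ν φm hν hφm h2 c hc i (heν i)).add_measure (heμ i))
  have := h3 α
  unfold mMom at this ⊢
  rw [integral_add_measure (hφp α) (hν α), integral_add_measure (hφm α) (hμ α)]
  linarith

end
end

section
/- Let μ and ν be finite positive Borel measures on ℝ^d satisfying Assumption 1, and for each n ∈ ℕ let ρ_n be the optimal value of the level-n semidefinite relaxation. Then the sequence (ρ_n) is monotone non-decreasing and ρ_n → ‖μ − ν‖_TV as n → ∞. -/
open MeasureTheory Finset Filter

noncomputable section

/-- Exponential integrability in the sup norm. -/
def ExpInt {d : ℕ} (κ : Measure (Fin d → ℝ)) : Prop :=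
  ∃ c : ℝ, 0 < c ∧ Integrable (fun x => Real.exp (c * ‖x‖)) κ

lemma ExpInt.of_coord {d : ℕ} {κ : Measure (Fin d → ℝ)} [IsFiniteMeasure κ] {c : ℝ} (hc : 0 < c)
    (h : ∀ i : Fin d, Integrable (fun x => Real.exp (c * |x i|)) κ) :
    Integrable (fun x => Real.exp (c * ‖x‖)) κ := by
  have h1 : Integrable (fun x : Fin d → ℝ => 1 + ∑ i, Real.exp (c * |x i|)) κ :=
    (integrable_const 1).add (integrable_finsetSum _ (fun i _ => h i))
  refine h1.mono' (by fun_prop) (ae_of_all _ fun x => ?_)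
  rw [Real.norm_eq_abs, abs_of_pos (Real.exp_pos _)]
  have hs : ∀ i, Real.exp (c * |x i|) ≤ ∑ i, Real.exp (c * |x i|) := fun i =>
    Finset.single_le_sum (f := fun i => Real.exp (c * |x i|))
      (fun j _ => (Real.exp_pos _).le) (Finset.mem_univ i)
  rcases isEmpty_or_nonempty (Fin d) with hd | hd
  · have : x = 0 := Subsingleton.elim _ _
    simp [this]
  · obtain ⟨i, -, hi⟩ := Finset.exists_max_image Finset.univ (fun i => ‖x i‖) Finset.univ_nonempty
    have h2 : ‖x‖ ≤ |x i| :=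
      (pi_norm_le_iff_of_nonneg (abs_nonneg _)).2 fun j => hi j (Finset.mem_univ j)
    have h3 : Real.exp (c * ‖x‖) ≤ Real.exp (c * |x i|) := by gcongr
    linarith [hs i]

lemma ExpInt.add {d : ℕ} {κ κ' : Measure (Fin d → ℝ)} (h : ExpInt κ) (h' : ExpInt κ') :
    ExpInt (κ + κ') := by
  obtain ⟨c, hc, hi⟩ := h
  obtain ⟨c', hc', hi'⟩ := h'
  refine ⟨min c c', lt_min hc hc', Integrable.add_measure ?_ ?_⟩
  · refine hi.mono' (by fun_prop) (ae_of_all _ fun x => ?_)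
    rw [Real.norm_eq_abs, abs_of_pos (Real.exp_pos _)]
    gcongr; exact min_le_left _ _
  · refine hi'.mono' (by fun_prop) (ae_of_all _ fun x => ?_)
    rw [Real.norm_eq_abs, abs_of_pos (Real.exp_pos _)]
    gcongr; exact min_le_right _ _

lemma ExpInt.pow {d : ℕ} {κ : Measure (Fin d → ℝ)} (h : ExpInt κ) (k : ℕ) :
    Integrable (fun x => ‖x‖ ^ k) κ := by
  obtain ⟨c, hc, hi⟩ := h
  refine (hi.const_mul (k.factorial / c ^ k)).mono' (by fun_prop) (ae_of_all _ fun x => ?_)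
  rw [Real.norm_eq_abs, abs_of_nonneg (by positivity)]
  have := Real.pow_div_factorial_le_exp (c * ‖x‖) (by positivity) k
  rw [div_le_iff₀ (by positivity), mul_pow] at this
  rw [div_mul_eq_mul_div, le_div_iff₀ (by positivity)]
  linarith

lemma ExpInt.poly {d : ℕ} {κ : Measure (Fin d → ℝ)} (h : ExpInt κ)
    (p : MvPolynomial (Fin d) ℝ) : Integrable (fun x => MvPolynomial.eval x p) κ := by
  have hm : ∀ p : MvPolynomial (Fin d) ℝ, Continuous fun x => MvPolynomial.eval x p :=
    fun p => MvPolynomial.continuous_eval p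
  induction p using MvPolynomial.induction_on' with
  | monomial u a =>
    refine ((h.pow (∑ i, u i)).const_mul |a|).mono' (hm _).aestronglyMeasurable
      (ae_of_all _ fun x => ?_)
    rw [MvPolynomial.eval_monomial, norm_mul, Real.norm_eq_abs,
      Finsupp.prod_fintype _ _ (by simp)]
    gcongr
    rw [Real.norm_eq_abs, Finset.abs_prod, ← Finset.prod_pow_eq_pow_sum]
    gcongr with i
    rw [abs_pow]
    gcongr
    exact norm_le_pi_norm x i
  | add p q hp hq =>
    simp only [map_add]
    exact hp.add hq

lemma ExpInt.poly_memLp {d : ℕ} {κ : Measure (Fin d → ℝ)} (h : ExpInt κ)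
    (p : MvPolynomial (Fin d) ℝ) : MemLp (fun x => MvPolynomial.eval x p) 2 κ := by
  rw [memLp_two_iff_integrable_sq (MvPolynomial.continuous_eval p).aestronglyMeasurable]
  have := h.poly (p ^ 2)
  simpa using this

lemma ExpInt.zero_mem {d : ℕ} {κ : Measure (Fin d → ℝ)} (h : ExpInt κ)
    (L : StrongDual ℝ (Fin d → ℝ)) :
    (0 : ℝ) ∈ interior (ProbabilityTheory.integrableExpSet L κ) := by
  obtain ⟨c, hc, hi⟩ := h
  rw [mem_interior_iff_mem_nhds, Metric.mem_nhds_iff]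
  refine ⟨c / (‖L‖ + 1), by positivity, fun t ht => ?_⟩
  rw [mem_ball_zero_iff, Real.norm_eq_abs, lt_div_iff₀ (by positivity)] at ht
  refine hi.mono' (by fun_prop) (ae_of_all _ fun x => ?_)
  rw [Real.norm_eq_abs, abs_of_pos (Real.exp_pos _)]
  apply Real.exp_le_exp.2
  calc t * L x ≤ |t * L x| := le_abs_self _
    _ = |t| * |L x| := abs_mul _ _
    _ ≤ |t| * (‖L‖ * ‖x‖) := by gcongr; exact L.le_opNorm x
    _ ≤ |t| * (‖L‖ + 1) * ‖x‖ := by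
      rw [← mul_assoc]; gcongr; linarith
    _ ≤ c * ‖x‖ := by gcongr

lemma dual_eq_eval {d : ℕ} (L : StrongDual ℝ (Fin d → ℝ)) (x : Fin d → ℝ) :
    L x = MvPolynomial.eval x
      (∑ i, MvPolynomial.C (L (Pi.single i 1)) * MvPolynomial.X i : MvPolynomial (Fin d) ℝ) := by
  conv_lhs => rw [← Finset.univ_sum_single x, map_sum]
  rw [map_sum]
  refine Finset.sum_congr rfl fun i _ => ?_
  have : Pi.single i (x i) = x i • (Pi.single i 1 : Fin d → ℝ) := by
    rw [← Pi.single_smul]; simp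
  rw [this, map_smul]
  simp [mul_comm]

open ProbabilityTheory in
/-- Moment determinacy. -/
lemma ExpInt.ext {d : ℕ} {κ κ' : Measure (Fin d → ℝ)} [IsFiniteMeasure κ] [IsFiniteMeasure κ']
    (h : ExpInt κ) (h' : ExpInt κ')
    (heq : ∀ p : MvPolynomial (Fin d) ℝ,
      ∫ x, MvPolynomial.eval x p ∂κ = ∫ x, MvPolynomial.eval x p ∂κ') : κ = κ' := by
  apply Measure.ext_of_charFunDual
  ext L
  have e1 : ∀ κ : Measure (Fin d → ℝ), charFunDual κ L = complexMGF L κ Complex.I := by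
    intro κ
    simp [charFunDual_apply, complexMGF, mul_comm]
  rw [e1, e1]
  set S := interior (integrableExpSet L κ) with hS
  set S' := interior (integrableExpSet L κ') with hS'
  have hz : (0 : ℝ) ∈ S := h.zero_mem L
  have hz' : (0 : ℝ) ∈ S' := h'.zero_mem L
  have hc : Convex ℝ (S ∩ S') :=
    convex_integrableExpSet.interior.inter convex_integrableExpSet.interior
  let U : Set ℂ := {z | z.re ∈ S ∩ S'}
  have hU : Convex ℝ U := hc.linear_preimage Complex.reLm
  have hf : AnalyticOnNhd ℂ (complexMGF L κ) U := analyticOnNhd_complexMGF.mono fun z hz => hz.1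
  have hg : AnalyticOnNhd ℂ (complexMGF L κ') U := analyticOnNhd_complexMGF.mono fun z hz => hz.2
  have h0 : (0 : ℂ) ∈ U := ⟨by simpa using hz, by simpa using hz'⟩
  have hI : Complex.I ∈ U := ⟨by simpa using hz, by simpa using hz'⟩
  refine hf.eqOn_of_preconnected_of_eventuallyEq hg hU.isPreconnected h0 ?_ hI
  have hsub : AnalyticAt ℂ (complexMGF L κ - complexMGF L κ') 0 := (hf 0 h0).sub (hg 0 h0)
  have hmom : ∀ n : ℕ, iteratedDeriv n (complexMGF L κ) 0 = iteratedDeriv n (complexMGF L κ') 0 := by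
    intro n
    rw [iteratedDeriv_complexMGF (by simpa using hz), iteratedDeriv_complexMGF (by simpa using hz')]
    have e2 : ∀ κ : Measure (Fin d → ℝ), ∫ x, (L x : ℂ) ^ n * Complex.exp (0 * L x) ∂κ =
        ((∫ x, MvPolynomial.eval x ((∑ i, MvPolynomial.C (L (Pi.single i 1)) *
          MvPolynomial.X i : MvPolynomial (Fin d) ℝ) ^ n) ∂κ : ℝ) : ℂ) := by
      intro κ
      rw [← integral_complex_ofReal]
      congr 1
      ext x
      rw [map_pow, ← dual_eq_eval]
      simp
    rw [e2, e2, heq]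
  have htop : analyticOrderAt (complexMGF L κ - complexMGF L κ') 0 = ⊤ := by
    rw [ENat.eq_top_iff_forall_ge]
    intro n
    rw [natCast_le_analyticOrderAt_iff_iteratedDeriv_eq_zero hsub]
    intro i _
    rw [iteratedDeriv_sub (hf 0 h0).contDiffAt (hg 0 h0).contDiffAt, hmom, sub_self]
  rw [analyticOrderAt_eq_top] at htop
  filter_upwards [htop] with z hz
  exact sub_eq_zero.1 hz

lemma ExpInt.withDensity {d : ℕ} {κ : Measure (Fin d → ℝ)} (h : ExpInt κ)
    {g : (Fin d → ℝ) → ℝ} (hm : Measurable g) (hg : MemLp g 2 κ) :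
    ExpInt (κ.withDensity fun x => ENNReal.ofReal (g x)) := by
  obtain ⟨c, hc, hi⟩ := h
  refine ⟨c / 2, by positivity, ?_⟩
  rw [integrable_withDensity_iff_integrable_smul' (by fun_prop) (ae_of_all _ fun x => by simp)]
  have h1 : MemLp (fun x : Fin d → ℝ => Real.exp (c / 2 * ‖x‖)) 2 κ := by
    rw [memLp_two_iff_integrable_sq (by fun_prop)]
    refine hi.congr (ae_of_all _ fun x => ?_)
    simp only
    rw [← Real.exp_nat_mul]
    congr 1
    push_cast; ring
  have h2 := hg.pos_part.integrable_mul h1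
  refine h2.congr (ae_of_all _ fun x => ?_)
  simp [ENNReal.toReal_ofReal']

lemma integral_withDensity_ofReal {d : ℕ} {κ : Measure (Fin d → ℝ)} 
    {g : (Fin d → ℝ) → ℝ} (hm : Measurable g) (f : (Fin d → ℝ) → ℝ) :
    ∫ x, f x ∂(κ.withDensity fun x => ENNReal.ofReal (g x)) = ∫ x, max (g x) 0 * f x ∂κ := by
  rw [integral_withDensity_eq_integral_toReal_smul (by fun_prop) (ae_of_all _ fun x => by simp)]
  simp [ENNReal.toReal_ofReal']

/-- A function in `L²` orthogonal to all polynomials vanishes. -/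
lemma ExpInt.ae_zero {d : ℕ} {κ : Measure (Fin d → ℝ)} [IsFiniteMeasure κ] (h : ExpInt κ)
    {g : (Fin d → ℝ) → ℝ} (hm : Measurable g) (hg : MemLp g 2 κ)
    (ho : ∀ p : MvPolynomial (Fin d) ℝ, ∫ x, g x * MvPolynomial.eval x p ∂κ = 0) :
    g =ᵐ[κ] 0 := by
  have hgi : Integrable g κ := hg.integrable (by norm_num)
  have i1 : IsFiniteMeasure (κ.withDensity fun x => ENNReal.ofReal (g x)) :=
    isFiniteMeasure_withDensity_ofReal hgi.2
  have i2 : IsFiniteMeasure (κ.withDensity fun x => ENNReal.ofReal ((-g) x)) :=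
    isFiniteMeasure_withDensity_ofReal hgi.neg.2
  have key := ExpInt.ext (h.withDensity hm hg) (h.withDensity hm.neg hg.neg) (by
    intro p
    rw [integral_withDensity_ofReal hm, integral_withDensity_ofReal hm.neg, ← sub_eq_zero,
      ← integral_sub]
    · refine Eq.trans ?_ (ho p)
      congr 1
      ext x
      rw [← sub_mul]
      congr 1
      simp only [Pi.neg_apply]
      exact posPart_sub_negPart (g x)
    · exact hg.pos_part.integrable_mul (h.poly_memLp p)
    · exact hg.neg.pos_part.integrable_mul (h.poly_memLp p))
  rw [withDensity_eq_iff (by fun_prop) (by fun_prop)] at key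
  · filter_upwards [key] with x hx
    simp only [Pi.neg_apply] at hx
    have := congrArg ENNReal.toReal hx
    simp only [ENNReal.toReal_ofReal'] at this
    simp only [Pi.zero_apply]
    rcases le_total (g x) 0 with h | h
    · rw [max_eq_right h, max_eq_left (by linarith)] at this; linarith
    · rw [max_eq_left h, max_eq_right (by linarith)] at this; linarith
  · have := i1.measure_univ_lt_top
    rw [withDensity_apply _ MeasurableSet.univ, Measure.restrict_univ] at this
    exact this.ne

/-- Density of polynomials in `L²`. -/
lemma ExpInt.dense {d : ℕ} {κ : Measure (Fin d → ℝ)} [IsFiniteMeasure κ] (h : ExpInt κ)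
    {f : (Fin d → ℝ) → ℝ} (hf : MemLp f 2 κ) {ε : ℝ} (hε : 0 < ε) :
    ∃ p : MvPolynomial (Fin d) ℝ, ∫ x, (f x - MvPolynomial.eval x p) ^ 2 ∂κ < ε := by
  let T : MvPolynomial (Fin d) ℝ →ₗ[ℝ] Lp ℝ 2 κ :=
    { toFun := fun p => (h.poly_memLp p).toLp
      map_add' := fun p q => by
        rw [← MemLp.toLp_add]; congr 1; ext x; simp
      map_smul' := fun c p => by
        simp only [RingHom.id_apply]
        rw [← MemLp.toLp_const_smul]; congr 1; ext x; simp }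
  have hT : ∀ p, T p = (h.poly_memLp p).toLp := fun p => rfl
  have htop : (LinearMap.range T).topologicalClosure = ⊤ := by
    rw [Submodule.topologicalClosure_eq_top_iff, Submodule.eq_bot_iff]
    intro g hg
    rw [Submodule.mem_orthogonal'] at hg
    have := h.ae_zero (Lp.stronglyMeasurable g).measurable (Lp.memLp g) (by
      intro p
      rw [← hg (T p) ⟨p, rfl⟩, L2.inner_def]
      apply integral_congr_ae
      filter_upwards [(h.poly_memLp p).coeFn_toLp] with x hx
      rw [hT, hx]
      simp [mul_comm])
    rwa [Lp.eq_zero_iff_ae_eq_zero]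
  have hmem : hf.toLp ∈ closure (LinearMap.range T : Set (Lp ℝ 2 κ)) := by
    rw [← Submodule.topologicalClosure_coe, htop]; trivial
  rw [Metric.mem_closure_iff] at hmem
  obtain ⟨_, ⟨p, rfl⟩, hp⟩ := hmem (√ε) (Real.sqrt_pos.2 hε)
  refine ⟨p, ?_⟩
  rw [dist_eq_norm, Real.lt_sqrt (norm_nonneg _), ← real_inner_self_eq_norm_sq, L2.inner_def] at hp
  refine lt_of_eq_of_lt (integral_congr_ae ?_) hp
  filter_upwards [(h.poly_memLp p).coeFn_toLp, hf.coeFn_toLp, Lp.coeFn_sub (hf.toLp) (T p)]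
    with x h1 h2 h3
  rw [h3, Pi.sub_apply, hT, h1, h2]
  simp [pow_two]

/-! ### The Riesz functional of a pseudo-moment vector -/

/-- The monomial index attached to a subtype element. -/
def idx {d n : ℕ} (a : {α : Fin d → ℕ // ∑ i, α i ≤ n}) : Fin d →₀ ℕ :=
  Finsupp.equivFunOnFinite.symm a.1

lemma eval_monomial_mono {d : ℕ} (u : Fin d →₀ ℕ) (c : ℝ) (x : Fin d → ℝ) :
    MvPolynomial.eval x (MvPolynomial.monomial u c) = c * mono d u x := by
  rw [MvPolynomial.eval_monomial, Finsupp.prod_fintype _ _ (by simp)]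
  rfl

/-- The linear functional on polynomials defined by a pseudo-moment vector. -/
def pvL {d n : ℕ} (φ : PV d n) : MvPolynomial (Fin d) ℝ →ₗ[ℝ] ℝ :=
  (MvPolynomial.basisMonomials (Fin d) ℝ).constr ℝ
    (fun u => if h : ∑ i, u i ≤ 2 * n then φ ⟨u, h⟩ else 0)

lemma pvL_monomial {d n : ℕ} (φ : PV d n) (u : Fin d →₀ ℕ) (c : ℝ) (h : ∑ i, u i ≤ 2 * n) :
    pvL φ (MvPolynomial.monomial u c) = c * φ ⟨u, h⟩ := by
  have : MvPolynomial.monomial u c = c • (MvPolynomial.basisMonomials (Fin d) ℝ) u := by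
    simp [MvPolynomial.smul_monomial]
  rw [this, map_smul, pvL, Module.Basis.constr_basis, dif_pos h]
  rfl

lemma poly_expand {d n : ℕ} (p : MvPolynomial (Fin d) ℝ) (hp : p.totalDegree ≤ n) :
    p = ∑ a : {α : Fin d → ℕ // ∑ i, α i ≤ n},
      MvPolynomial.monomial (idx a) (MvPolynomial.coeff (idx a) p) := by
  ext u
  rw [MvPolynomial.coeff_sum]
  simp only [MvPolynomial.coeff_monomial]
  by_cases hu : ∑ i, u i ≤ n
  · rw [Finset.sum_eq_single (⟨u, hu⟩ : {α : Fin d → ℕ // ∑ i, α i ≤ n})]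
    · have : idx (⟨u, hu⟩ : {α : Fin d → ℕ // ∑ i, α i ≤ n}) = u := by
        ext i; rfl
      rw [this, if_pos rfl]
    · intro b _ hb
      rw [if_neg]
      rintro rfl
      exact hb (Subtype.ext rfl)
    · simp
  · rw [Finset.sum_eq_zero]
    · apply MvPolynomial.coeff_eq_zero_of_totalDegree_lt
      have : ∑ i ∈ u.support, u i = ∑ i, u i := Finsupp.sum_fintype u (fun _ k => k) (by simp)
      rw [this]
      omega
    · intro b _
      rw [if_neg]
      rintro rfl
      exact hu b.2

lemma pvL_sub {d n : ℕ} {μ ν : Measure (Fin d → ℝ)} (hμ : HasAllMoments μ) (hν : HasAllMoments ν)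
    {φ ψ : PV d n} (h : ∀ α, φ α - ψ α = mMom μ α.1 - mMom ν α.1)
    (p : MvPolynomial (Fin d) ℝ) (hp : p.totalDegree ≤ 2 * n) :
    pvL φ p - pvL ψ p = ∫ x, MvPolynomial.eval x p ∂μ - ∫ x, MvPolynomial.eval x p ∂ν := by
  have hint : ∀ κ : Measure (Fin d → ℝ), HasAllMoments κ → ∫ x, MvPolynomial.eval x p ∂κ =
      ∑ a : {α : Fin d → ℕ // ∑ i, α i ≤ 2 * n}, MvPolynomial.coeff (idx a) p * mMom κ a.1 := by
    intro κ hκ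
    conv_lhs => rw [poly_expand p hp]
    simp only [map_sum, eval_monomial_mono]
    rw [integral_finsetSum _ (fun a _ => (hκ _).const_mul _)]
    refine Finset.sum_congr rfl fun a _ => ?_
    rw [integral_const_mul]
    rfl
  have hL : ∀ φ : PV d n, pvL φ p =
      ∑ a : {α : Fin d → ℕ // ∑ i, α i ≤ 2 * n}, MvPolynomial.coeff (idx a) p * φ a := by
    intro φ
    conv_lhs => rw [poly_expand p hp]
    rw [map_sum]
    refine Finset.sum_congr rfl fun a _ => ?_
    rw [pvL_monomial φ (idx a) _ a.2]
    rfl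
  rw [hint μ hμ, hint ν hν, hL, hL, ← Finset.sum_sub_distrib, ← Finset.sum_sub_distrib]
  refine Finset.sum_congr rfl fun a _ => ?_
  rw [← mul_sub, h a, mul_sub]

lemma quad_expand {d n : ℕ}
    (M : Matrix {α : Fin d → ℕ // ∑ i, α i ≤ n} {α : Fin d → ℕ // ∑ i, α i ≤ n} ℝ)
    (v : {α : Fin d → ℕ // ∑ i, α i ≤ n} → ℝ) :
    star v ⬝ᵥ (M.mulVec v) = ∑ a, ∑ b, v a * v b * M a b := by
  simp only [dotProduct, Matrix.mulVec, Finset.mul_sum]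
  refine Finset.sum_congr rfl fun a _ => Finset.sum_congr rfl fun b _ => ?_
  simp only [Pi.star_apply, star_trivial]
  ring

lemma mono_add {d : ℕ} (a b : Fin d → ℕ) (x : Fin d → ℝ) :
    mono d (a + b) x = mono d a x * mono d b x := by
  simp [mono, pow_add, Finset.prod_mul_distrib]

lemma quad_momMat {d n : ℕ} {κ : Measure (Fin d → ℝ)} (hκ : HasAllMoments κ)
    (v : {α : Fin d → ℕ // ∑ i, α i ≤ n} → ℝ) :
    Integrable (fun x => (∑ a, v a * mono d a.1 x) ^ 2) κ ∧
    star v ⬝ᵥ ((momMat d n (mMom κ)).mulVec v) = ∫ x, (∑ a, v a * mono d a.1 x) ^ 2 ∂κ := by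
  have e : (fun x => (∑ a, v a * mono d a.1 x) ^ 2) =
      fun x => ∑ a, ∑ b, v a * v b * mono d (a.1 + b.1) x := by
    ext x
    rw [pow_two, Finset.sum_mul_sum]
    refine Finset.sum_congr rfl fun a _ => Finset.sum_congr rfl fun b _ => ?_
    rw [mono_add]; ring
  rw [e]
  constructor
  · exact integrable_finsetSum _ fun a _ => integrable_finsetSum _ fun b _ => (hκ _).const_mul _
  · rw [quad_expand, integral_finsetSum _
      (fun a _ => integrable_finsetSum _ fun b _ => (hκ _).const_mul _)]
    refine Finset.sum_congr rfl fun a _ => ?_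
    rw [integral_finsetSum _ (fun b _ => (hκ _).const_mul _)]
    refine Finset.sum_congr rfl fun b _ => ?_
    rw [integral_const_mul]
    rfl

lemma pvL_mul_self {d n : ℕ} (φ : PV d n) (p : MvPolynomial (Fin d) ℝ) (hp : p.totalDegree ≤ n) :
    pvL φ (p * p) = star (fun a => MvPolynomial.coeff (idx a) p) ⬝ᵥ
      ((pvMat d n φ).mulVec (fun a => MvPolynomial.coeff (idx a) p)) := by
  rw [quad_expand]
  conv_lhs => rw [poly_expand p hp]
  rw [Finset.sum_mul_sum]
  simp only [map_sum, MvPolynomial.monomial_mul]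
  refine Finset.sum_congr rfl fun a _ => Finset.sum_congr rfl fun b _ => ?_
  rw [pvL_monomial φ (idx a + idx b) _ (by
    have ha := a.2
    have hb := b.2
    have : ∑ i, (idx a + idx b) i = ∑ i, a.1 i + ∑ i, b.1 i := by
      rw [← Finset.sum_add_distrib]; rfl
    omega)]
  rfl

lemma pvL_bounds {d n : ℕ} {κ : Measure (Fin d → ℝ)} (hκ : HasAllMoments κ) (φ : PV d n)
    (h1 : (pvMat d n φ).PosSemidef) (h2 : (momMat d n (mMom κ) - pvMat d n φ).PosSemidef)
    (p : MvPolynomial (Fin d) ℝ) (hp : p.totalDegree ≤ n) :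
    0 ≤ pvL φ (p * p) ∧ pvL φ (p * p) ≤ ∫ x, (MvPolynomial.eval x p) ^ 2 ∂κ := by
  rw [pvL_mul_self φ p hp]
  refine ⟨h1.dotProduct_mulVec_nonneg _, ?_⟩
  have := h2.dotProduct_mulVec_nonneg (fun a => MvPolynomial.coeff (idx a) p)
  rw [Matrix.sub_mulVec, dotProduct_sub, sub_nonneg, (quad_momMat hκ _).2] at this
  refine this.trans (le_of_eq ?_)
  congr 1
  ext x
  congr 1
  conv_rhs => rw [poly_expand p hp]
  simp only [map_sum, eval_monomial_mono]
  rfl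

lemma pvL_one {d n : ℕ} (φ : PV d n) : pvL φ 1 = φ (zeroIdx d n) := by
  have := pvL_monomial φ 0 1 (by simp)
  rw [one_mul] at this
  exact this

/-! ### Monotonicity -/

lemma primalSet_bddBelow (d n : ℕ) (μ ν : Measure (Fin d → ℝ)) :
    BddBelow (primalSet d n μ ν) := by
  refine ⟨0, ?_⟩
  rintro r ⟨φ, ψ, ⟨-, h1, -, h2, -⟩, rfl⟩
  have e1 := h1.diag_nonneg (i := ⟨0, by simp⟩)
  have e2 := h2.diag_nonneg (i := ⟨0, by simp⟩)
  exact add_nonneg e1 e2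

lemma primalSet_anti (d : ℕ) {n m : ℕ} (hnm : n ≤ m) (μ ν : Measure (Fin d → ℝ)) :
    primalSet d m μ ν ⊆ primalSet d n μ ν := by
  rintro r ⟨φ, ψ, ⟨h0, h1, h2, h3, h4⟩, rfl⟩
  let e : {α : Fin d → ℕ // ∑ i, α i ≤ n} → {α : Fin d → ℕ // ∑ i, α i ≤ m} :=
    fun a => ⟨a.1, a.2.trans hnm⟩
  let f : {α : Fin d → ℕ // ∑ i, α i ≤ 2 * n} → {α : Fin d → ℕ // ∑ i, α i ≤ 2 * m} :=
    fun a => ⟨a.1, a.2.trans (by omega)⟩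
  exact ⟨fun a => φ (f a), fun a => ψ (f a),
    ⟨fun α => h0 (f α), h1.submatrix e, h2.submatrix e, h3.submatrix e, h4.submatrix e⟩, rfl⟩

/-! ### The Hahn-Jordan decomposition -/

lemma hj_apply {d : ℕ} (μ ν : Measure (Fin d → ℝ)) [IsFiniteMeasure μ] [IsFiniteMeasure ν]
    {A : Set (Fin d → ℝ)} (hA : MeasurableSet A) :
    (hjPos μ ν).real A - (hjNeg μ ν).real A = μ.real A - ν.real A := by
  rw [hjPos, hjNeg, ← SignedMeasure.apply_eq_posPart_real_sub_negPart_real _ hA,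
    Measure.toSignedMeasure_sub_apply hA]

instance hjPos_finite {d : ℕ} (μ ν : Measure (Fin d → ℝ)) [IsFiniteMeasure μ]
    [IsFiniteMeasure ν] : IsFiniteMeasure (hjPos μ ν) := by
  unfold hjPos; infer_instance

instance hjNeg_finite {d : ℕ} (μ ν : Measure (Fin d → ℝ)) [IsFiniteMeasure μ]
    [IsFiniteMeasure ν] : IsFiniteMeasure (hjNeg μ ν) := by
  unfold hjNeg; infer_instance

lemma hj_set {d : ℕ} (μ ν : Measure (Fin d → ℝ)) [IsFiniteMeasure μ] [IsFiniteMeasure ν] :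
    ∃ S, MeasurableSet S ∧ hjPos μ ν S = 0 ∧ hjNeg μ ν Sᶜ = 0 :=
  (μ.toSignedMeasure - ν.toSignedMeasure).toJordanDecomposition.mutuallySingular

lemma hjPos_le {d : ℕ} (μ ν : Measure (Fin d → ℝ)) [IsFiniteMeasure μ] [IsFiniteMeasure ν] :
    hjPos μ ν ≤ μ := by
  obtain ⟨S, hS, h1, h2⟩ := hj_set μ ν
  rw [Measure.le_iff]
  intro A hA
  have e1 : hjPos μ ν A ≤ hjPos μ ν (A ∩ Sᶜ) := by
    calc hjPos μ ν A ≤ hjPos μ ν ((A ∩ Sᶜ) ∪ S) := measure_mono (by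
          intro x hx; by_cases h : x ∈ S <;> simp [h, hx])
      _ ≤ hjPos μ ν (A ∩ Sᶜ) + hjPos μ ν S := measure_union_le _ _
      _ = _ := by rw [h1, add_zero]
  have e2 : hjNeg μ ν (A ∩ Sᶜ) = 0 := measure_mono_null Set.inter_subset_right h2
  have e3 := hj_apply μ ν (hA.inter hS.compl)
  rw [measureReal_def (hjNeg μ ν), e2] at e3
  have e4 : (hjPos μ ν).real (A ∩ Sᶜ) ≤ μ.real (A ∩ Sᶜ) := by
    have := measureReal_nonneg (μ := ν) (s := A ∩ Sᶜ)
    simp at e3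
    linarith
  rw [measureReal_def, measureReal_def, ENNReal.toReal_le_toReal (by simp) (by simp)] at e4
  exact e1.trans (e4.trans (measure_mono Set.inter_subset_left))

lemma hj_add {d : ℕ} (μ ν : Measure (Fin d → ℝ)) [IsFiniteMeasure μ] [IsFiniteMeasure ν] :
    hjPos μ ν + ν = hjNeg μ ν + μ := by
  ext A hA
  rw [← ENNReal.toReal_eq_toReal_iff' (by simp) (by simp)]
  have := hj_apply μ ν hA
  have e1 := measureReal_add_apply (μ₁ := hjPos μ ν) (μ₂ := ν) (s := A)
  have e2 := measureReal_add_apply (μ₁ := hjNeg μ ν) (μ₂ := μ) (s := A)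
  rw [← measureReal_def, ← measureReal_def, e1, e2]
  linarith

lemma hjNeg_le {d : ℕ} (μ ν : Measure (Fin d → ℝ)) [IsFiniteMeasure μ] [IsFiniteMeasure ν] :
    hjNeg μ ν ≤ ν := by
  have h := hj_add μ ν
  rw [Measure.le_iff]
  intro A hA
  have e : hjPos μ ν A + ν A = hjNeg μ ν A + μ A := by
    rw [← Measure.add_apply, h, Measure.add_apply]
  have : μ A + hjNeg μ ν A ≤ μ A + ν A := by
    rw [add_comm, ← e]; gcongr; exact hjPos_le μ ν
  exact (ENNReal.add_le_add_iff_left (by simp)).1 this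

lemma HasAllMoments.mono {d : ℕ} {κ κ' : Measure (Fin d → ℝ)} (h : HasAllMoments κ) (hle : κ' ≤ κ) :
    HasAllMoments κ' := fun α => (h α).mono_measure hle

lemma momMat_symm {d n : ℕ} (m : (Fin d → ℕ) → ℝ) : (momMat d n m).IsHermitian := by
  ext a b
  simp [momMat, add_comm]

lemma momMat_psd {d n : ℕ} {κ : Measure (Fin d → ℝ)} (h : HasAllMoments κ) :
    (momMat d n (mMom κ)).PosSemidef := by
  refine .of_dotProduct_mulVec_nonneg (momMat_symm _) fun v => ?_
  rw [(quad_momMat h v).2]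
  positivity

lemma momMat_sub_psd {d n : ℕ} {κ κ' : Measure (Fin d → ℝ)} (h : HasAllMoments κ) (hle : κ' ≤ κ) :
    (momMat d n (mMom κ) - momMat d n (mMom κ')).PosSemidef := by
  refine .of_dotProduct_mulVec_nonneg ((momMat_symm _).sub (momMat_symm _)) fun v => ?_
  rw [Matrix.sub_mulVec, dotProduct_sub, sub_nonneg, (quad_momMat h v).2,
    (quad_momMat (h.mono hle) v).2]
  exact integral_mono_measure hle (ae_of_all _ fun x => by positivity) (quad_momMat h v).1

lemma tv_mem {d : ℕ} (n : ℕ) (μ ν : Measure (Fin d → ℝ)) [IsFiniteMeasure μ] [IsFiniteMeasure ν]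
    (hμ : HasAllMoments μ) (hν : HasAllMoments ν) : tvReal μ ν ∈ primalSet d n μ ν := by
  have hp := hμ.mono (hjPos_le μ ν)
  have hn := hν.mono (hjNeg_le μ ν)
  refine ⟨fun α => mMom (hjPos μ ν) α.1, fun α => mMom (hjNeg μ ν) α.1,
    ⟨?_, momMat_psd hp, momMat_sub_psd hμ (hjPos_le μ ν), momMat_psd hn,
      momMat_sub_psd hν (hjNeg_le μ ν)⟩, ?_⟩
  · intro α
    have h := congrArg (fun κ => mMom κ α.1) (hj_add μ ν)
    simp only [mMom] at h ⊢
    rw [integral_add_measure (hp _) (hν _), integral_add_measure (hn _) (hμ _)] at h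
    linarith
  · have e : ∀ κ : Measure (Fin d → ℝ), mMom κ (zeroIdx d n).1 = κ.real Set.univ := by
      intro κ
      simp [mMom, zeroIdx, mono]
    simp only [e]
    rw [tvReal, ENNReal.toReal_add (by simp) (by simp)]
    rfl

lemma tv_sign {d : ℕ} (μ ν : Measure (Fin d → ℝ)) [IsFiniteMeasure μ] [IsFiniteMeasure ν] :
    ∃ σ : (Fin d → ℝ) → ℝ, Measurable σ ∧ (∀ x, σ x ^ 2 = 1) ∧
      ∫ x, σ x ∂μ - ∫ x, σ x ∂ν = tvReal μ ν := by
  obtain ⟨S, hS, h1, h2⟩ := hj_set μ ν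
  refine ⟨fun x => 1 - 2 * S.indicator (fun _ => (1 : ℝ)) x, ?_, ?_, ?_⟩
  · exact measurable_const.sub ((measurable_const.indicator hS).const_mul 2)
  · intro x
    by_cases h : x ∈ S <;> simp [h]; norm_num
  · have e : ∀ κ : Measure (Fin d → ℝ), IsFiniteMeasure κ →
        ∫ x, (1 - 2 * S.indicator (fun _ => (1 : ℝ)) x) ∂κ =
          κ.real Set.univ - 2 * κ.real S := by
      intro κ _
      rw [integral_sub (integrable_const _)
        (((integrable_const (1 : ℝ)).indicator hS).const_mul 2), integral_const_mul,
        integral_indicator hS]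
      simp
    rw [e μ inferInstance, e ν inferInstance]
    have a1 := hj_apply μ ν MeasurableSet.univ
    have a2 := hj_apply μ ν hS
    have a3 : (hjPos μ ν).real S = 0 := by rw [measureReal_def, h1]; rfl
    have a4 : (hjNeg μ ν).real Sᶜ = 0 := by rw [measureReal_def, h2]; rfl
    have a5 := measureReal_add_measureReal_compl (μ := hjNeg μ ν) hS
    rw [tvReal, ENNReal.toReal_add (by simp) (by simp), ← measureReal_def, ← measureReal_def]
    linarith

/-! ### The lower bound -/

lemma riesz_cs {d n : ℕ} (L : MvPolynomial (Fin d) ℝ →ₗ[ℝ] ℝ)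
    (hL : ∀ p : MvPolynomial (Fin d) ℝ, p.totalDegree ≤ n → 0 ≤ L (p * p))
    (a b : MvPolynomial (Fin d) ℝ) (ha : a.totalDegree ≤ n) (hb : b.totalDegree ≤ n)
    {η A B : ℝ} (hη : 0 < η) (hA : L (a * a) ≤ A) (hB : L (b * b) ≤ B * η ^ 2) :
    -(η * (A + B)) / 2 ≤ L (a * b) := by
  have h := hL (η • a + b) ((MvPolynomial.totalDegree_add _ _).trans
    (max_le ((MvPolynomial.totalDegree_smul_le _ _).trans ha) hb))
  have e : (η • a + b) * (η • a + b) = η ^ 2 • (a * a) + (2 * η) • (a * b) + b * b := by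
    simp only [MvPolynomial.smul_eq_C_mul, map_mul, map_pow, map_ofNat]
    ring
  rw [e, map_add, map_add, map_smul, map_smul, smul_eq_mul, smul_eq_mul] at h
  have h1 : η ^ 2 * L (a * a) ≤ η ^ 2 * A := by gcongr
  have h2 : 0 ≤ η * (η * (A + B) + 2 * L (a * b)) := by nlinarith
  have h3 := nonneg_of_mul_nonneg_right h2 hη
  linarith

lemma riesz_lower {d n : ℕ} {lam κ : Measure (Fin d → ℝ)} [IsFiniteMeasure lam] (hlam : ExpInt lam)
    (hle : κ ≤ lam) (L : MvPolynomial (Fin d) ℝ →ₗ[ℝ] ℝ)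
    (hL : ∀ p : MvPolynomial (Fin d) ℝ, p.totalDegree ≤ n →
      0 ≤ L (p * p) ∧ L (p * p) ≤ ∫ x, (MvPolynomial.eval x p) ^ 2 ∂κ)
    (s t : MvPolynomial (Fin d) ℝ) (hs : 2 * s.totalDegree ≤ n)
    (ht : 2 * t.totalDegree ≤ n) {η : ℝ} (hη : 0 < η) (hη1 : η ≤ 1)
    (σ : (Fin d → ℝ) → ℝ) (hσm : Measurable σ) (hσ : ∀ x, σ x ^ 2 = 1)
    (h1 : ∫ x, (σ x - MvPolynomial.eval x s) ^ 2 ∂lam ≤ η ^ 2)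
    (h2 : ∫ x, (1 + (MvPolynomial.eval x s) ^ 2) * (σ x - MvPolynomial.eval x t) ^ 2 ∂lam ≤ η ^ 2) :
    -(η * (3 * lam.real Set.univ + 10)) / 2 ≤ L (1 - s * s) := by
  have hL' : ∀ p : MvPolynomial (Fin d) ℝ, p.totalDegree ≤ n →
      L (p * p) ≤ ∫ x, (MvPolynomial.eval x p) ^ 2 ∂lam := fun p hp =>
    (hL p hp).2.trans (integral_mono_measure hle (ae_of_all _ fun x => by positivity) (by
      have := hlam.poly (p ^ 2)
      simpa using this))
  have hσp : ∀ p : MvPolynomial (Fin d) ℝ, Integrable (fun x => σ x * MvPolynomial.eval x p) lam := by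
    intro p
    refine (hlam.poly p).bdd_mul hσm.aestronglyMeasurable (c := 1) (ae_of_all _ fun x => ?_)
    rw [Real.norm_eq_abs, ← sq_le_one_iff_abs_le_one, hσ]
  have i1 : Integrable (fun x => (σ x - MvPolynomial.eval x s) ^ 2) lam := by
    have := ((hlam.poly (1 + s ^ 2)).sub ((hσp s).const_mul 2))
    refine this.congr (ae_of_all _ fun x => ?_)
    simp
    linear_combination - hσ x
  have i2 : Integrable (fun x => (1 + (MvPolynomial.eval x s) ^ 2) *
      (σ x - MvPolynomial.eval x t) ^ 2) lam := by
    have := ((hlam.poly ((1 + s ^ 2) * (1 + t ^ 2))).sub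
      ((hσp ((1 + s ^ 2) * t)).const_mul 2))
    refine this.congr (ae_of_all _ fun x => ?_)
    simp
    linear_combination - (1 + (MvPolynomial.eval x s) ^ 2) * hσ x
  have b0 : L (1 * 1) ≤ lam.real Set.univ := by
    refine (hL' 1 (by simp)).trans (le_of_eq ?_)
    simp
  have d1 : (1 - s * t).totalDegree ≤ n := by
    refine (MvPolynomial.totalDegree_sub _ _).trans (max_le (by simp) ?_)
    refine (MvPolynomial.totalDegree_mul _ _).trans ?_
    omega
  have d2 : (t - s).totalDegree ≤ n :=
    (MvPolynomial.totalDegree_sub _ _).trans (max_le (by omega) (by omega))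
  have b1 : L ((1 - s * t) * (1 - s * t)) ≤ 4 * η ^ 2 := by
    refine (hL' _ d1).trans ?_
    have : ∫ x, (MvPolynomial.eval x (1 - s * t)) ^ 2 ∂lam ≤
        ∫ x, (2 * (σ x - MvPolynomial.eval x s) ^ 2 + 2 * ((1 + (MvPolynomial.eval x s) ^ 2) *
          (σ x - MvPolynomial.eval x t) ^ 2)) ∂lam := by
      refine integral_mono_of_nonneg (ae_of_all _ fun x => by positivity)
        ((i1.const_mul 2).add (i2.const_mul 2)) (ae_of_all _ fun x => ?_)
      simp only [map_sub, map_one, map_mul]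
      have hx := hσ x
      set S := MvPolynomial.eval x s
      set T := MvPolynomial.eval x t
      have e1 : (1 - S * σ x) ^ 2 = (σ x - S) ^ 2 := by linear_combination (S ^ 2 - 1) * hx
      have e2 : (1 - S * T) ^ 2 ≤ 2 * (1 - S * σ x) ^ 2 + 2 * (S * (σ x - T)) ^ 2 := by
        nlinarith [sq_nonneg ((1 - S * σ x) - S * (σ x - T))]
      rw [e1] at e2
      nlinarith [sq_nonneg (σ x - T)]
    rw [integral_add (i1.const_mul 2) (i2.const_mul 2), integral_const_mul, integral_const_mul] at this
    linarith
  have b2 : L ((t - s) * (t - s)) ≤ 4 * η ^ 2 := by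
    refine (hL' _ d2).trans ?_
    have : ∫ x, (MvPolynomial.eval x (t - s)) ^ 2 ∂lam ≤
        ∫ x, (2 * (σ x - MvPolynomial.eval x s) ^ 2 + 2 * ((1 + (MvPolynomial.eval x s) ^ 2) *
          (σ x - MvPolynomial.eval x t) ^ 2)) ∂lam := by
      refine integral_mono_of_nonneg (ae_of_all _ fun x => by positivity)
        ((i1.const_mul 2).add (i2.const_mul 2)) (ae_of_all _ fun x => ?_)
      simp only [map_sub]
      set S := MvPolynomial.eval x s
      set T := MvPolynomial.eval x t
      have e2 : (T - S) ^ 2 ≤ 2 * (σ x - S) ^ 2 + 2 * (σ x - T) ^ 2 := by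
        nlinarith [sq_nonneg ((σ x - S) + (σ x - T))]
      nlinarith [mul_nonneg (sq_nonneg S) (sq_nonneg (σ x - T))]
    rw [integral_add (i1.const_mul 2) (i2.const_mul 2), integral_const_mul, integral_const_mul] at this
    linarith
  have b3 : L (s * s) ≤ 2 * lam.real Set.univ + 2 := by
    refine (hL' _ (by omega)).trans ?_
    have : ∫ x, (MvPolynomial.eval x s) ^ 2 ∂lam ≤
        ∫ x, (2 + 2 * (σ x - MvPolynomial.eval x s) ^ 2) ∂lam := by
      refine integral_mono_of_nonneg (ae_of_all _ fun x => by positivity)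
        ((integrable_const _).add (i1.const_mul 2)) (ae_of_all _ fun x => ?_)
      have hx := hσ x
      set S := MvPolynomial.eval x s
      simp only
      nlinarith [sq_nonneg (2 * σ x - S)]
    rw [integral_add (integrable_const _) (i1.const_mul 2), integral_const_mul, integral_const,
      smul_eq_mul] at this
    nlinarith
  have c1 := riesz_cs L (fun p hp => (hL p hp).1) 1 (1 - s * t) (by simp) d1 hη b0 b1
  have c2 := riesz_cs L (fun p hp => (hL p hp).1) s (t - s) (by omega) d2 hη b3 b2
  have e : (1 - s * s : MvPolynomial (Fin d) ℝ) = 1 * (1 - s * t) + s * (t - s) := by ring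
  rw [e, map_add]
  linarith

lemma lower_bound {d : ℕ} (μ ν : Measure (Fin d → ℝ)) [IsFiniteMeasure μ] [IsFiniteMeasure ν]
    (hμ : HasAllMoments μ) (hν : HasAllMoments ν) (eμ : ExpInt μ) (eν : ExpInt ν)
    {η : ℝ} (hη : 0 < η) (hη1 : η ≤ 1) :
    ∃ N : ℕ, ∀ n, N ≤ n → ∀ r ∈ primalSet d n μ ν,
      tvReal μ ν - η * (2 * (μ + ν).real Set.univ + 6) ≤ r := by
  obtain ⟨σ, hσm, hσ, htv⟩ := tv_sign μ ν
  have hlam : ExpInt (μ + ν) := eμ.add eν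
  have hb : ∀ x, ‖σ x‖ ≤ 1 := fun x => by
    rw [Real.norm_eq_abs, ← sq_le_one_iff_abs_le_one, hσ]
  have hσL : ∀ κ : Measure (Fin d → ℝ), IsFiniteMeasure κ → MemLp σ 2 κ := fun κ _ =>
    MemLp.of_bound hσm.aestronglyMeasurable 1 (ae_of_all _ hb)
  obtain ⟨s, hs⟩ := hlam.dense (hσL _ inferInstance) (ε := η ^ 2) (by positivity)
  have hwm : Measurable fun x : Fin d → ℝ => 1 + (MvPolynomial.eval x s) ^ 2 := by
    have := (MvPolynomial.continuous_eval s).measurable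
    fun_prop
  have hw : MemLp (fun x : Fin d → ℝ => 1 + (MvPolynomial.eval x s) ^ 2) 2 (μ + ν) := by
    have := hlam.poly_memLp (1 + s ^ 2)
    simpa using this
  have hw1 := hlam.withDensity hwm hw
  have hw2 : IsFiniteMeasure ((μ + ν).withDensity fun x =>
      ENNReal.ofReal (1 + (MvPolynomial.eval x s) ^ 2)) :=
    isFiniteMeasure_withDensity_ofReal (hw.integrable (by norm_num)).2
  obtain ⟨t, ht⟩ := hw1.dense (hσL _ hw2) (ε := η ^ 2) (by positivity)
  rw [integral_withDensity_ofReal hwm] at ht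
  have ht' : ∫ x, (1 + (MvPolynomial.eval x s) ^ 2) * (σ x - MvPolynomial.eval x t) ^ 2 ∂(μ + ν)
      ≤ η ^ 2 := by
    refine le_trans (le_of_eq ?_) ht.le
    congr 1
    ext x
    rw [max_eq_left (by positivity)]
  refine ⟨2 * s.totalDegree + 2 * t.totalDegree, ?_⟩
  rintro n hn r ⟨φ, ψ, ⟨h0, h1, h2, h3, h4⟩, rfl⟩
  have k1 := riesz_lower hlam (Measure.le_add_right le_rfl : μ ≤ μ + ν) (pvL φ)
    (pvL_bounds hμ φ h1 h2) s t (by omega) (by omega) hη hη1 σ hσm hσ hs.le ht'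
  have k2 := riesz_lower hlam (Measure.le_add_left le_rfl : ν ≤ μ + ν) (pvL ψ)
    (pvL_bounds hν ψ h3 h4) s t (by omega) (by omega) hη hη1 σ hσm hσ hs.le ht'
  have k3 := pvL_sub hμ hν h0 s (by omega)
  have k4 := (pvL_bounds hμ φ h1 h2 (1 - s)
    ((MvPolynomial.totalDegree_sub _ _).trans (max_le (by simp) (by omega)))).1
  have k5 := (pvL_bounds hν ψ h3 h4 (1 + s)
    ((MvPolynomial.totalDegree_add _ _).trans (max_le (by simp) (by omega)))).1
  have e4 : ((1 - s) * (1 - s) : MvPolynomial (Fin d) ℝ) = (2 : ℝ) • 1 - (2 : ℝ) • s - (1 - s * s) := by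
    simp only [MvPolynomial.smul_eq_C_mul, map_ofNat]; ring
  have e5 : ((1 + s) * (1 + s) : MvPolynomial (Fin d) ℝ) = (2 : ℝ) • 1 + (2 : ℝ) • s - (1 - s * s) := by
    simp only [MvPolynomial.smul_eq_C_mul, map_ofNat]; ring
  rw [e4] at k4
  rw [e5] at k5
  simp only [map_sub, map_add, map_smul, smul_eq_mul] at k1 k2 k4 k5
  have hσi : ∀ κ : Measure (Fin d → ℝ), IsFiniteMeasure κ → Integrable σ κ := fun κ hκ =>
    (hσL κ hκ).integrable (by norm_num)
  -- comparison of the integrals of `s` and `σ`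
  have isq : ∀ κ : Measure (Fin d → ℝ), IsFiniteMeasure κ → ExpInt κ →
      Integrable (fun x => (σ x - MvPolynomial.eval x s) ^ 2) κ := fun κ hκ eκ =>
    ((hσL κ hκ).sub (eκ.poly_memLp s)).integrable_sq
  have q : ∀ κ : Measure (Fin d → ℝ), IsFiniteMeasure κ → ExpInt κ →
      |∫ x, MvPolynomial.eval x s ∂κ - ∫ x, σ x ∂κ| ≤
        (η * κ.real Set.univ + η⁻¹ * ∫ x, (σ x - MvPolynomial.eval x s) ^ 2 ∂κ) / 2 := by
    intro κ hκ eκ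
    rw [← integral_sub (eκ.poly s) (hσi κ hκ)]
    have : ∫ x, ‖MvPolynomial.eval x s - σ x‖ ∂κ ≤
        ∫ x, (η / 2 + (η⁻¹ / 2) * (σ x - MvPolynomial.eval x s) ^ 2) ∂κ := by
      refine integral_mono_of_nonneg (ae_of_all _ fun x => by positivity)
        ((integrable_const _).add ((isq κ hκ eκ).const_mul _)) (ae_of_all _ fun x => ?_)
      simp only [Real.norm_eq_abs]
      rw [abs_sub_comm, ← sq_abs (σ x - _)]
      set z := |σ x - MvPolynomial.eval x s|
      have : η / 2 + η⁻¹ / 2 * z ^ 2 - z = η⁻¹ / 2 * (z - η) ^ 2 := by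
        field_simp; ring
      have h' : 0 ≤ η⁻¹ / 2 * (z - η) ^ 2 := by positivity
      linarith
    rw [integral_add (integrable_const _) ((isq κ hκ eκ).const_mul _), integral_const_mul,
      integral_const, smul_eq_mul] at this
    have h' := norm_integral_le_integral_norm (μ := κ) (fun x => MvPolynomial.eval x s - σ x)
    rw [Real.norm_eq_abs] at h'
    linarith
  have qμ := abs_le.1 (q μ inferInstance eμ)
  have qν := abs_le.1 (q ν inferInstance eν)
  have hs' := hs.le
  rw [integral_add_measure (isq μ inferInstance eμ) (isq ν inferInstance eν)] at hs'
  have hs2 : η⁻¹ * (∫ x, (σ x - MvPolynomial.eval x s) ^ 2 ∂μ +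
      ∫ x, (σ x - MvPolynomial.eval x s) ^ 2 ∂ν) ≤ η := by
    calc _ ≤ η⁻¹ * η ^ 2 := by gcongr
      _ = η := by field_simp
  have hC : (μ + ν).real Set.univ = μ.real Set.univ + ν.real Set.univ :=
    measureReal_add_apply
  rw [hC] at k1 k2 ⊢
  rw [← pvL_one φ, ← pvL_one ψ]
  have := measureReal_nonneg (μ := μ) (s := Set.univ)
  have := measureReal_nonneg (μ := ν) (s := Set.univ)
  nlinarith [qμ.1, qν.2]

/-- Under Assumption 1, the sequence `ρ_n` of optimal values of the level-`n`
semidefinite relaxations is monotone non-decreasing and converges to `‖μ - ν‖_TV`. -/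
theorem rho_monotone_tendsto_tv (d : ℕ) (μ ν : Measure (Fin d → ℝ))
    [IsFiniteMeasure μ] [IsFiniteMeasure ν] (hA : Assumption1 μ ν) :
    Monotone (fun n => rho d n μ ν) ∧
    Tendsto (fun n => rho d n μ ν) atTop (nhds (tvReal μ ν)) := by
  obtain ⟨hμ, hν, c, hc, h1, h2⟩ := hA
  have eμ : ExpInt μ := ⟨c, hc, ExpInt.of_coord hc h1⟩
  have eν : ExpInt ν := ⟨c, hc, ExpInt.of_coord hc h2⟩
  refine ⟨fun n m hnm => csInf_le_csInf (primalSet_bddBelow d n μ ν) ⟨_, tv_mem m μ ν hμ hν⟩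
    (primalSet_anti d hnm μ ν), ?_⟩
  rw [Metric.tendsto_atTop]
  intro ε hε
  set K := 2 * (μ + ν).real Set.univ + 6 with hK
  have hKpos : 0 < K := by
    have := measureReal_nonneg (μ := μ + ν) (s := Set.univ)
    linarith
  obtain ⟨N, hN⟩ := lower_bound μ ν hμ hν eμ eν (η := min 1 (ε / (2 * K)))
    (lt_min one_pos (by positivity)) (min_le_left _ _)
  refine ⟨N, fun n hn => ?_⟩
  have up : rho d n μ ν ≤ tvReal μ ν := csInf_le (primalSet_bddBelow d n μ ν) (tv_mem n μ ν hμ hν)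
  have lo := le_csInf (s := primalSet d n μ ν) ⟨_, tv_mem n μ ν hμ hν⟩ (hN n hn)
  have hlt : min 1 (ε / (2 * K)) * K ≤ ε / 2 := by
    calc _ ≤ (ε / (2 * K)) * K := by gcongr; exact min_le_right _ _
      _ = ε / 2 := by field_simp
  change _ ≤ rho d n μ ν at lo
  rw [Real.dist_eq, abs_lt]
  constructor <;> linarith

end
end
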